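/- arXiv:1211.1277 — 3 statements merged into one kernel-verified Lean document; each statement's English description precedes it below -/
import Mathlib

section
/- Let k be a field and let A be a commutative integral domain which is a finitely generated k-algebra, graded by the monoid ℕ × ℤ^r (so A = ⊕_{(n,λ)∈ℕ×ℤ^r} A_{(n,λ)} with A_{(n,λ)}·A_{(m,μ)} ⊆ A_{(n+m,λ+μ)}), such that A_{(0,0)} = k·1 and A_{(0,λ)} = 0 for all λ ≠ 0. Then the set Δ(A) = { λ/n ∈ ℚ^r : n ≥ 1, λ ∈ ℤ^r, A_{(n,λ)} ≠ 0 } is the set of rational points of a rational convex polytope; more precisely, there exist finitely many points v_1, …, v_s ∈ ℚ^r such that Δ(A) equals the intersection of ℚ^r with the convex hull of v_1, …, v_s in ℝ^r. -/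
/-- A rational point in the real convex hull of rational points lies in their rational
convex hull. -/
theorem mem_convexHull_rat_of_mem_convexHull_real {ι : Type*} {s : Set (ι → ℚ)} {q : ι → ℚ}
    (hq : (fun i => (q i : ℝ)) ∈
      convexHull ℝ ((fun (v : ι → ℚ) (i : ι) => (v i : ℝ)) '' s)) :
    q ∈ convexHull ℚ s := by
  obtain ⟨κ, _, z, w, hz, hind, hpos, hsum, heq⟩ := eq_pos_convex_span_of_mem_convexHull hq
  have hzv : ∀ j, ∃ v ∈ s, (fun i => ((v i : ℚ) : ℝ)) = z j := fun j => hz ⟨j, rfl⟩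
  choose v hvs hvz using hzv
  -- A `ℚ`-linear retraction `ℝ → ℚ` sends the weights to rational weights; affine independence
  -- shows that it fixes them.
  obtain ⟨φ, hφ⟩ := (Algebra.linearMap ℚ ℝ).exists_leftInverse_of_injective
    (LinearMap.ker_eq_bot.2 (algebraMap ℚ ℝ).injective)
  have hφ' : ∀ x : ℚ, φ (x : ℝ) = x := fun x => by
    simpa using LinearMap.congr_fun hφ x
  have hsumφ : ∑ j, φ (w j) = 1 := by
    rw [← map_sum, hsum]; simpa using hφ' 1
  have heqφ : ∀ i, ∑ j, φ (w j) * v j i = q i := fun i => by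
    have h := congrFun heq i
    simp only [Finset.sum_apply, Pi.smul_apply, ← hvz, smul_eq_mul] at h
    rw [← hφ' (q i), ← h, map_sum]
    refine Finset.sum_congr rfl fun j _ => ?_
    rw [show w j * (v j i : ℝ) = v j i • w j by rw [Rat.smul_def, mul_comm], map_smul,
      smul_eq_mul, mul_comm]
  have hfix : ∀ j, ((φ (w j) : ℚ) : ℝ) = w j := fun j => by
    refine sub_eq_zero.1 (affineIndependent_iff.1 hind Finset.univ
      (fun j => ((φ (w j) : ℚ) : ℝ) - w j) ?_ ?_ j (Finset.mem_univ j))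
    · rw [Finset.sum_sub_distrib, hsum, ← Rat.cast_sum, hsumφ]; simp
    · simp only [sub_smul, Finset.sum_sub_distrib, heq]
      rw [sub_eq_zero]
      funext i
      simp only [Finset.sum_apply, Pi.smul_apply, ← hvz, smul_eq_mul]
      rw [← heqφ i]; push_cast; rfl
  have hq' : q = ∑ j, φ (w j) • v j := by
    funext i; simp [heqφ]
  rw [hq']
  refine (convex_convexHull ℚ s).sum_mem (fun j _ => ?_) hsumφ
    fun j _ => subset_convexHull ℚ s (hvs j)
  have := (hpos j).le
  rw [← hfix j] at this
  exact_mod_cast this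

theorem mem_convexHull_real_of_mem_convexHull_rat {ι : Type*} {s : Set (ι → ℚ)} {q : ι → ℚ}
    (hq : q ∈ convexHull ℚ s) :
    (fun i => (q i : ℝ)) ∈
      convexHull ℝ ((fun (v : ι → ℚ) (i : ι) => (v i : ℝ)) '' s) := by
  refine convexHull_min (t := {q : ι → ℚ | (fun i => (q i : ℝ)) ∈
      convexHull ℝ ((fun (v : ι → ℚ) (i : ι) => (v i : ℝ)) '' s)})
    (fun v hv => subset_convexHull ℝ _ ⟨v, hv, rfl⟩) ?_ hq
  intro x hx y hy a b ha hb hab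
  have := convex_convexHull ℝ _ hx hy (a := (a : ℝ)) (b := (b : ℝ)) (by exact_mod_cast ha)
    (by exact_mod_cast hb) (by exact_mod_cast hab)
  rw [Set.mem_ofPred_eq]
  convert this using 1
  funext i
  simp

/-- The degrees of a finitely generated graded algebra lie in a finitely generated submonoid
of the grading monoid, generated by degrees that do occur. -/
theorem GradedAlgebra.exists_finset_degrees_subset_closure {k A M : Type*} [CommSemiring k]
    [CommSemiring A] [Algebra k A] [AddCommMonoid M] [DecidableEq M] (𝒜 : M → Submodule k A)
    [GradedAlgebra 𝒜] (hfg : Algebra.FiniteType k A) :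
    ∃ G : Finset M, (∀ d ∈ G, 𝒜 d ≠ ⊥) ∧
      ∀ d, 𝒜 d ≠ ⊥ → d ∈ AddSubmonoid.closure (G : Set M) := by
  classical
  obtain ⟨T, hT⟩ := hfg.out
  let G : Finset M := T.biUnion fun t => (DirectSum.decompose 𝒜 t).support
  refine ⟨G, fun d hd hbot => ?_, fun d hd => ?_⟩
  · obtain ⟨t, -, ht⟩ := Finset.mem_biUnion.1 hd
    rw [DFinsupp.mem_support_iff] at ht
    apply ht
    ext
    simpa [hbot] using (DirectSum.decompose 𝒜 t d).2
  · have key : ∀ a : A, a ∈ ⨆ e : AddSubmonoid.closure (G : Set M), 𝒜 e := by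
      intro a
      have ha : a ∈ Algebra.adjoin k (T : Set A) := hT ▸ Algebra.mem_top
      have hmem : ∀ e ∈ AddSubmonoid.closure (G : Set M), ∀ x ∈ 𝒜 e,
          x ∈ ⨆ e : AddSubmonoid.closure (G : Set M), 𝒜 e := fun e he x hx =>
        Submodule.mem_iSup_of_mem (p := fun e : AddSubmonoid.closure (G : Set M) => 𝒜 e)
          ⟨e, he⟩ hx
      induction ha using Algebra.adjoin_induction with
      | mem x hx =>
        rw [← DirectSum.sum_support_decompose 𝒜 x]
        refine Submodule.sum_mem _ fun e he => hmem e (AddSubmonoid.subset_closure ?_) _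
          (DirectSum.decompose 𝒜 x e).2
        exact Finset.mem_coe.2 (Finset.mem_biUnion.2 ⟨x, hx, he⟩)
      | algebraMap c =>
        exact hmem 0 (zero_mem _) _ (SetLike.algebraMap_mem_graded 𝒜 c)
      | add x y _ _ hx hy => exact add_mem hx hy
      | mul x y _ _ hx hy =>
        have hxy := Submodule.mul_mem_mul hx hy
        rw [Submodule.iSup_mul] at hxy
        refine SetLike.le_def.1 (iSup_le fun e => ?_) hxy
        rw [Submodule.mul_iSup]
        refine iSup_le fun f => Submodule.mul_le.2 fun a ha b hb =>
          hmem _ (add_mem e.2 f.2) _ (SetLike.mul_mem_graded ha hb)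
    by_contra hdG
    refine hd ((Submodule.eq_bot_iff _).2 fun x hx => ?_)
    rw [← DirectSum.decompose_of_mem_same 𝒜 hx]
    refine Submodule.iSup_induction (fun e : AddSubmonoid.closure (G : Set M) => 𝒜 e)
      (motive := fun y => (DirectSum.decompose 𝒜 y d : A) = 0) (key x) ?_ ?_ ?_
    · exact fun e y hy => DirectSum.decompose_of_mem_ne 𝒜 hy fun h => hdG (h ▸ e.2)
    · simp
    · intro y z hy hz
      simp [DirectSum.decompose_add, hy, hz]

/-!
STATEMENT 0: For a finitely generated ℕ × ℤ^r-graded integral domain `A` over a field `k`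
with `A_{(0,0)} = k·1` and `A_{(0,λ)} = 0` for `λ ≠ 0`, the set
`Δ(A) = { λ/n : n ≥ 1, A_{(n,λ)} ≠ 0 }` is the set of rational points of a rational
convex polytope.
-/

theorem moment_set_is_rational_polytope
    (k A : Type*) [Field k] [CommRing A] [IsDomain A] [Algebra k A]
    (hfg : Algebra.FiniteType k A) (r : ℕ)
    (𝒜 : ℕ × (Fin r → ℤ) → Submodule k A) [GradedAlgebra 𝒜]
    (h00 : 𝒜 (0, 0) = Submodule.span k {(1 : A)})
    (h0 : ∀ lam : Fin r → ℤ, lam ≠ 0 → 𝒜 (0, lam) = ⊥) :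
    ∃ s : Finset (Fin r → ℚ),
      {q : Fin r → ℚ | ∃ (n : ℕ) (lam : Fin r → ℤ), 1 ≤ n ∧ 𝒜 (n, lam) ≠ ⊥ ∧
          q = fun i => (lam i : ℚ) / (n : ℚ)} =
      {q : Fin r → ℚ | (fun i => (q i : ℝ)) ∈
          convexHull ℝ ((fun (v : Fin r → ℚ) (i : Fin r) => (v i : ℝ)) '' (s : Set (Fin r → ℚ)))} := by
  classical
  obtain ⟨G, hG, hcl⟩ := GradedAlgebra.exists_finset_degrees_subset_closure 𝒜 hfg
  let p : ℕ × (Fin r → ℤ) → Fin r → ℚ := fun d i => (d.2 i : ℚ) / (d.1 : ℚ)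
  let s : Finset (Fin r → ℚ) := (G.filter fun d => 1 ≤ d.1).image p
  refine ⟨s, Set.Subset.antisymm ?_ ?_⟩
  · rintro q ⟨n, lam, hn, hne, rfl⟩
    apply mem_convexHull_real_of_mem_convexHull_rat
    have key : ∀ d ∈ AddSubmonoid.closure (G : Set (ℕ × (Fin r → ℤ))),
        d = 0 ∨ (1 ≤ d.1 ∧ p d ∈ convexHull ℚ (s : Set (Fin r → ℚ))) := by
      intro d hd
      induction hd using AddSubmonoid.closure_induction with
      | mem d hd =>
        by_cases h1 : 1 ≤ d.1
        · exact Or.inr ⟨h1, subset_convexHull ℚ _ (Finset.mem_coe.2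
            (Finset.mem_image_of_mem p (Finset.mem_filter.2 ⟨hd, h1⟩)))⟩
        · obtain ⟨m, mu⟩ := d
          obtain rfl : m = 0 := by simpa using h1
          left
          by_contra hmu
          exact hG _ hd (h0 mu fun h => hmu (by rw [h]; rfl))
      | zero => exact Or.inl rfl
      | add x y _ _ hx hy =>
        rcases hx with rfl | ⟨hx1, hx⟩
        · simpa using hy
        rcases hy with rfl | ⟨hy1, hy⟩
        · right; simpa using ⟨hx1, hx⟩
        refine Or.inr ⟨le_add_right hx1, ?_⟩
        have hx0 : (0 : ℚ) < x.1 := by exact_mod_cast hx1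
        have hy0 : (0 : ℚ) < y.1 := by exact_mod_cast hy1
        have := convex_convexHull ℚ _ hx hy (a := (x.1 : ℚ) / (x.1 + y.1))
          (b := (y.1 : ℚ) / (x.1 + y.1)) (by positivity) (by positivity) (by field_simp)
        convert this using 1
        funext i
        simp only [p, Prod.fst_add, Prod.snd_add, Pi.add_apply, Pi.smul_apply, smul_eq_mul]
        push_cast
        field_simp
    rcases key _ (hcl _ hne) with h | h
    · rw [Prod.mk_eq_zero] at h; omega
    · exact h.2
  · intro q hq
    have hadd : ∀ d e, 𝒜 d ≠ ⊥ → 𝒜 e ≠ ⊥ → 𝒜 (d + e) ≠ ⊥ := by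
      intro d e hd he h
      obtain ⟨x, hx, hx0⟩ := Submodule.exists_mem_ne_zero_of_ne_bot hd
      obtain ⟨y, hy, hy0⟩ := Submodule.exists_mem_ne_zero_of_ne_bot he
      have hxy := SetLike.mul_mem_graded hx hy
      rw [h, Submodule.mem_bot] at hxy
      exact mul_ne_zero hx0 hy0 hxy
    have hzero : 𝒜 0 ≠ ⊥ := fun h => one_ne_zero (α := A)
      ((Submodule.mem_bot k).1 (h ▸ SetLike.one_mem_graded 𝒜))
    have hsmul : ∀ (c : ℕ) d, 𝒜 d ≠ ⊥ → 𝒜 (c • d) ≠ ⊥ := by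
      intro c d hd
      induction c with
      | zero => simpa using hzero
      | succ c ih => rw [succ_nsmul]; exact hadd _ _ ih hd
    refine convexHull_min ?_ ?_ (mem_convexHull_rat_of_mem_convexHull_real hq)
    · intro v hv
      obtain ⟨d, hd, rfl⟩ := Finset.mem_image.1 (Finset.mem_coe.1 hv)
      rw [Finset.mem_filter] at hd
      exact ⟨d.1, d.2, hd.2, hG _ hd.1, rfl⟩
    · rintro _ ⟨n, lam, hn, hnl, rfl⟩ _ ⟨m, mu, hm, hmm, rfl⟩ a b ha hb hab
      -- Clear denominators: both weights are fractions over `c = a.den * b.den`.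
      let a' : ℕ := a.num.toNat * b.den
      let b' : ℕ := b.num.toNat * a.den
      let c : ℕ := a.den * b.den
      have hc : 0 < c := Nat.mul_pos a.den_pos b.den_pos
      have hcQ : (0 : ℚ) < c := by exact_mod_cast hc
      have hnum : ∀ x : ℚ, 0 ≤ x → ((x.num.toNat : ℕ) : ℚ) = x * x.den := fun x hx => by
        rw [Rat.mul_den_eq_num]
        exact_mod_cast Int.toNat_of_nonneg (Rat.num_nonneg.2 hx)
      have ha' : (a' : ℚ) = a * c := by
        simp only [a', c]; push_cast; rw [hnum a ha]; ring
      have hb' : (b' : ℚ) = b * c := by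
        simp only [b', c]; push_cast; rw [hnum b hb]; ring
      have habc : a' + b' = c := by
        have : (a' : ℚ) + b' = c := by rw [ha', hb', ← add_mul, hab, one_mul]
        exact_mod_cast this
      have hnQ : (0 : ℚ) < n := by exact_mod_cast hn
      have hmQ : (0 : ℚ) < m := by exact_mod_cast hm
      have hdeg : (a' * m) • (n, lam) + (b' * n) • (m, mu) =
          (c * n * m, (a' * m) • lam + (b' * n) • mu) := by
        refine Prod.ext ?_ rfl
        simp only [Prod.fst_add, Prod.smul_fst, smul_eq_mul, ← habc]
        ring
      refine ⟨c * n * m, (a' * m) • lam + (b' * n) • mu,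
        Nat.mul_pos (Nat.mul_pos hc hn) hm, ?_, ?_⟩
      · rw [← hdeg]
        exact hadd _ _ (hsmul _ _ hnl) (hsmul _ _ hmm)
      · funext i
        simp only [Pi.add_apply, Pi.smul_apply, smul_eq_mul]
        rw [nsmul_eq_mul, nsmul_eq_mul]
        push_cast
        rw [ha', hb']
        field_simp
end

section
/- Let d ≥ 1 and let Γ be an additive submonoid of ℕ × ℤ^d. Let C(Γ) be the smallest closed convex cone in ℝ × ℝ^d containing Γ, and let Δ(Γ) = {x ∈ ℝ^d : (1, x) ∈ C(Γ)} be the Okounkov body of Γ. For k ∈ ℕ let H_Γ(k) be the number of points x ∈ ℤ^d with (k, x) ∈ Γ. Assume (a) the subgroup of ℤ × ℤ^d generated by Γ is all of ℤ × ℤ^d, and (b) C(Γ) ∩ ({0} × ℝ^d) = {(0,0)} (so that Δ(Γ) is a compact convex set and each H_Γ(k) is finite). Then H_Γ(k)/k^d converges, as k → ∞, to the d-dimensional Lebesgue volume of Δ(Γ). -/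
/-!
STATEMENT 3: Kaveh–Khovanskii approximation theorem, part (i), full-rank case:
for a submonoid `Γ` of `ℕ × ℤ^d` generating `ℤ × ℤ^d` as a group and whose closed convex
cone `C(Γ)` meets `{0} × ℝ^d` only in `0`, the number `H_Γ(k)` of points of `Γ` at level `k`
satisfies `H_Γ(k)/k^d → vol (Δ(Γ))`, where `Δ(Γ)` is the Okounkov body of `Γ`.
-/

open Filter MeasureTheory Pointwise

/-- The embedding of `ℤ × ℤ^d` into `ℝ × ℝ^d`. -/
def latticeEmb (d : ℕ) : ℤ × (Fin d → ℤ) →+ ℝ × (Fin d → ℝ) :=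
  (Int.castAddHom ℝ).prodMap ((Int.castAddHom ℝ).compLeft (Fin d))

lemma latticeEmb_apply {d : ℕ} (x : ℤ × (Fin d → ℤ)) :
    latticeEmb d x = ((x.1 : ℝ), fun i => (x.2 i : ℝ)) := rfl

/-- A zonotope spanned by finitely many lattice vectors contains finitely many lattice points. -/
lemma finite_latticeEmb_zonotope {d : ℕ} (G : Finset (ℤ × (Fin d → ℤ))) :
    {x | ∃ c : ℤ × (Fin d → ℤ) → ℝ, (∀ g ∈ G, c g ∈ Set.Icc (0 : ℝ) 1) ∧
      latticeEmb d x = ∑ g ∈ G, c g • latticeEmb d g}.Finite := by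
  classical
  have key : ∀ (c f : ℤ × (Fin d → ℤ) → ℝ), (∀ g ∈ G, c g ∈ Set.Icc (0 : ℝ) 1) →
      |∑ g ∈ G, c g * f g| ≤ ∑ g ∈ G, |f g| := fun c f hc =>
    (Finset.abs_sum_le_sum_abs _ _).trans <| Finset.sum_le_sum fun g hg => by
      rw [abs_mul, abs_of_nonneg (hc g hg).1]
      exact mul_le_of_le_one_left (abs_nonneg _) (hc g hg).2
  refine (Set.finite_Icc (-∑ g ∈ G, (|g.1|, |g.2|)) (∑ g ∈ G, (|g.1|, |g.2|))).subset ?_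
  rintro x ⟨c, hc, hx⟩
  have h1 : |x.1| ≤ ∑ g ∈ G, |g.1| := by
    have h := congrArg Prod.fst hx
    simp only [latticeEmb_apply, Prod.fst_sum, Prod.smul_fst, smul_eq_mul] at h
    have := key c (fun g => (g.1 : ℝ)) hc
    rw [← h] at this
    exact_mod_cast this
  have h2 : ∀ i, |x.2 i| ≤ ∑ g ∈ G, |g.2 i| := fun i => by
    have h := congrArg (fun p => p.2 i) hx
    simp only [latticeEmb_apply, Prod.snd_sum, Prod.smul_snd, Finset.sum_apply, Pi.smul_apply,
      smul_eq_mul] at h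
    have := key c (fun g => (g.2 i : ℝ)) hc
    rw [← h] at this
    exact_mod_cast this
  simp only [Set.mem_Icc, Prod.le_def, Pi.le_def, Prod.fst_neg, Prod.snd_neg, Prod.fst_sum,
    Prod.snd_sum, Pi.neg_apply, Finset.sum_apply, Pi.abs_apply]
  exact ⟨⟨(abs_le.1 h1).1, fun i => (abs_le.1 (h2 i)).1⟩,
    (abs_le.1 h1).2, fun i => (abs_le.1 (h2 i)).2⟩

/-- A finitely generated submonoid generating the lattice contains all the lattice points of some
translate of its cone. -/
lemma exists_add_mem_closure_of_mem_cone {d : ℕ} (G : Finset (ℤ × (Fin d → ℤ)))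
    (hG : AddSubgroup.closure (G : Set (ℤ × (Fin d → ℤ))) = ⊤) :
    ∃ γ ∈ AddSubmonoid.closure (G : Set (ℤ × (Fin d → ℤ))),
      ∀ (x : ℤ × (Fin d → ℤ)) (c : ℤ × (Fin d → ℤ) → ℝ), (∀ g ∈ G, 0 ≤ c g) →
        latticeEmb d x = ∑ g ∈ G, c g • latticeEmb d g →
        γ + x ∈ AddSubmonoid.closure (G : Set (ℤ × (Fin d → ℤ))) := by
  have hspan : ∀ x : ℤ × (Fin d → ℤ), ∃ f : ℤ × (Fin d → ℤ) → ℤ, ∑ g ∈ G, f g • g = x := by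
    intro x
    have hx : x ∈ AddSubgroup.closure (G : Set (ℤ × (Fin d → ℤ))) := hG ▸ AddSubgroup.mem_top x
    rw [← Submodule.span_int_eq_addSubgroupClosure] at hx
    obtain ⟨f, -, hf⟩ := Submodule.mem_span_finset.1 hx
    exact ⟨f, hf⟩
  choose f hf using hspan
  set P := (finite_latticeEmb_zonotope G).toFinset with hP
  set N : ℤ := ∑ p ∈ P, ∑ g ∈ G, |f p g| with hN
  have hN0 : 0 ≤ N := Finset.sum_nonneg fun _ _ => Finset.sum_nonneg fun _ _ => abs_nonneg _
  have hmem : ∀ a : ℤ × (Fin d → ℤ) → ℤ, (∀ g ∈ G, 0 ≤ a g) →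
      ∑ g ∈ G, a g • g ∈ AddSubmonoid.closure (G : Set (ℤ × (Fin d → ℤ))) := by
    intro a ha
    refine sum_mem fun g hg => ?_
    rw [← Int.toNat_of_nonneg (ha g hg), natCast_zsmul]
    exact nsmul_mem (AddSubmonoid.subset_closure hg) _
  refine ⟨∑ g ∈ G, N • g, hmem (fun _ => N) fun _ _ => hN0, fun x c hc hx => ?_⟩
  set p := x - ∑ g ∈ G, ⌊c g⌋ • g with hp
  have hpP : p ∈ P := by
    rw [hP, Set.Finite.mem_toFinset]
    refine ⟨fun g => Int.fract (c g), fun g _ => ⟨Int.fract_nonneg _, (Int.fract_lt_one _).le⟩, ?_⟩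
    simp only [hp, map_sub, map_sum, map_zsmul, hx, ← Finset.sum_sub_distrib, Int.fract, sub_smul,
      Int.cast_smul_eq_zsmul]
  have hbd : ∀ g ∈ G, |f p g| ≤ N := fun g hg =>
    (Finset.single_le_sum (f := fun g => |f p g|) (fun _ _ => abs_nonneg _) hg).trans
      (Finset.single_le_sum (f := fun p => ∑ g ∈ G, |f p g|)
        (fun _ _ => Finset.sum_nonneg fun _ _ => abs_nonneg _) hpP)
  have hsum : ∑ g ∈ G, N • g + x = ∑ g ∈ G, (N + ⌊c g⌋ + f p g) • g := by
    simp only [add_smul, Finset.sum_add_distrib, hf p]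
    rw [hp]; abel
  rw [hsum]
  refine hmem _ fun g hg => ?_
  have := (abs_le.1 (hbd g hg)).1
  have := Int.floor_nonneg.2 (hc g hg)
  linarith

lemma finite_setOf_inv_smul_mem {d : ℕ} {s : Set (Fin d → ℝ)} (hs : Bornology.IsBounded s) {n : ℕ}
    (hn : n ≠ 0) : {y : Fin d → ℤ | (n : ℝ)⁻¹ • (fun i => (y i : ℝ)) ∈ s}.Finite := by
  obtain ⟨R, hR⟩ := hs.exists_norm_le
  have hn0 : (0 : ℝ) < n := by positivity
  refine (Set.finite_Icc (fun _ => -⌈n * R⌉) (fun _ => ⌈n * R⌉)).subset fun y hy => ?_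
  have h : ∀ i, |y i| ≤ ⌈n * R⌉ := fun i => by
    have h1 := (norm_le_pi_norm _ i).trans (hR _ hy)
    simp only [Pi.smul_apply, smul_eq_mul, norm_mul, norm_inv, Real.norm_eq_abs, Nat.abs_cast] at h1
    rw [inv_mul_le_iff₀ hn0] at h1
    have := h1.trans (Int.le_ceil _)
    exact_mod_cast this
  exact ⟨fun i => (abs_le.1 (h i)).1, fun i => (abs_le.1 (h i)).2⟩

/-- The number of points of `n⁻¹ ℤ^d` in a bounded set with null frontier is asymptotic to its
volume times `n ^ d`. -/
lemma tendsto_ncard_inv_smul_mem_div_pow {d : ℕ} {s : Set (Fin d → ℝ)}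
    (hs : Bornology.IsBounded s) (hm : MeasurableSet s) (hf : volume (frontier s) = 0) :
    Tendsto (fun n : ℕ =>
      ({y : Fin d → ℤ | (n : ℝ)⁻¹ • (fun i => (y i : ℝ)) ∈ s}.ncard : ℝ) / (n : ℝ) ^ d)
      atTop (nhds (volume s).toReal) := by
  have h := tendsto_card_div_pow_atTop_volume s hs hm hf
  rw [Fintype.card_fin] at h
  refine h.congr' ?_
  filter_upwards [eventually_gt_atTop 0] with n hn
  have hn0 : (n : ℝ)⁻¹ ≠ 0 := by positivity
  congr 2
  rw [Nat.card_coe_set_eq, ← Set.ncard_image_of_injective (f := fun y : Fin d → ℤ =>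
    (n : ℝ)⁻¹ • (fun i => (y i : ℝ)))]
  · congr 1
    ext z
    simp only [Set.mem_inter_iff, Set.mem_smul_set, SetLike.mem_coe, Set.mem_image,
      Set.mem_ofPred_eq, Module.Basis.mem_span_iff_repr_mem, Pi.basisFun_repr, Set.mem_range,
      algebraMap_int_eq, eq_intCast]
    constructor
    · rintro ⟨hz, w, hw, rfl⟩
      choose y hy using hw
      obtain rfl : (fun i => (y i : ℝ)) = w := funext hy
      exact ⟨y, hz, rfl⟩
    · rintro ⟨y, hy, rfl⟩
      exact ⟨hy, _, fun i => ⟨y i, rfl⟩, rfl⟩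
  · intro y z hyz
    have := smul_right_injective _ hn0 hyz
    exact funext fun i => by exact_mod_cast congrFun this i

/-- The points `x / k` for `(k, x) ∈ G` with `k > 0`. -/
def slopes {d : ℕ} (G : Set (ℤ × (Fin d → ℤ))) : Set (Fin d → ℝ) :=
  (fun g => (g.1 : ℝ)⁻¹ • fun i => (g.2 i : ℝ)) '' {g ∈ G | 0 < g.1}

lemma slopes_mono {d : ℕ} : Monotone (slopes (d := d)) :=
  fun _ _ h => Set.image_mono fun _ hg => ⟨h hg.1, hg.2⟩

lemma one_mk_inv_smul {d : ℕ} (g : ℤ × (Fin d → ℤ)) (hg : 0 < g.1) :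
    ((1 : ℝ), (g.1 : ℝ)⁻¹ • fun i => (g.2 i : ℝ)) = (g.1 : ℝ)⁻¹ • latticeEmb d g := by
  have : (g.1 : ℝ) ≠ 0 := by exact_mod_cast hg.ne'
  rw [latticeEmb_apply, Prod.smul_mk, smul_eq_mul, inv_mul_cancel₀ this]

lemma exists_eq_sum_of_mem_convexHull_slopes {d : ℕ} (G : Finset (ℤ × (Fin d → ℤ)))
    {y : Fin d → ℝ} (hy : y ∈ convexHull ℝ (slopes (G : Set (ℤ × (Fin d → ℤ))))) :
    ∃ c : ℤ × (Fin d → ℤ) → ℝ, (∀ g ∈ G, 0 ≤ c g) ∧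
      ((1 : ℝ), y) = ∑ g ∈ G, c g • latticeEmb d g := by
  classical
  refine convexHull_min (t := {y : Fin d → ℝ | ∃ c : ℤ × (Fin d → ℤ) → ℝ, (∀ g ∈ G, 0 ≤ c g) ∧
      ((1 : ℝ), y) = ∑ g ∈ G, c g • latticeEmb d g}) ?_ ?_ hy
  · rintro _ ⟨g, ⟨hg, hpos⟩, rfl⟩
    refine ⟨Pi.single g (g.1 : ℝ)⁻¹, fun h _ => ?_, ?_⟩
    · rcases eq_or_ne h g with rfl | hne
      · simp [hpos.le]
      · simp [hne]
    · rw [Finset.sum_eq_single g (fun h _ hne => by simp [hne]) (fun h => (h hg).elim),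
        Pi.single_eq_same]
      exact one_mk_inv_smul g hpos
  · rintro y ⟨c, hc, hy⟩ z ⟨e, he, hz⟩ a b ha hb hab
    refine ⟨fun g => a * c g + b * e g, fun g hg =>
      add_nonneg (mul_nonneg ha (hc g hg)) (mul_nonneg hb (he g hg)), ?_⟩
    simp only [add_smul, mul_smul, Finset.sum_add_distrib, ← Finset.smul_sum, ← hy, ← hz,
      Prod.smul_mk, Prod.mk_add_mk, smul_eq_mul, mul_one, hab]

/-- The lower bound on the number of points of `Γ` at a given level which comes from a finite
subset of `Γ` generating the lattice. -/
lemma eventually_lt_ncard_div_pow {d : ℕ} {Γ : AddSubmonoid (ℤ × (Fin d → ℤ))}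
    (hΓnat : ∀ γ ∈ Γ, 0 ≤ γ.1)
    (hfin : ∀ n : ℕ, n ≠ 0 → {x : Fin d → ℤ | ((n : ℤ), x) ∈ Γ}.Finite)
    {G : Finset (ℤ × (Fin d → ℤ))} (hGΓ : (G : Set (ℤ × (Fin d → ℤ))) ⊆ Γ)
    (hG : AddSubgroup.closure (G : Set (ℤ × (Fin d → ℤ))) = ⊤) {b : ℝ}
    (hb : b < (volume (convexHull ℝ (slopes (G : Set (ℤ × (Fin d → ℤ)))))).toReal) :
    ∀ᶠ n : ℕ in atTop, b < ({x : Fin d → ℤ | ((n : ℤ), x) ∈ Γ}.ncard : ℝ) / (n : ℝ) ^ d := by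
  obtain ⟨γ, hγ, hcone⟩ := exists_add_mem_closure_of_mem_cone G hG
  have hcl : AddSubmonoid.closure (G : Set (ℤ × (Fin d → ℤ))) ≤ Γ :=
    AddSubmonoid.closure_le.2 hGΓ
  obtain ⟨k, hk⟩ := Int.eq_ofNat_of_zero_le (hΓnat γ (hcl hγ))
  set D := convexHull ℝ (slopes (G : Set (ℤ × (Fin d → ℤ)))) with hD
  have hDc : IsCompact D :=
    ((G.finite_toSet.subset (Set.sep_subset _ _)).image _).isCompact_convexHull ℝ
  have hlim := tendsto_ncard_inv_smul_mem_div_pow hDc.isBounded hDc.measurableSet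
    ((convex_convexHull ℝ _).addHaar_frontier volume)
  have hratio : Tendsto (fun m : ℕ => ((m : ℝ) / (m + k)) ^ d) atTop (nhds 1) := by
    simpa using (tendsto_natCast_div_add_atTop (k : ℝ)).pow d
  have hlim' := hlim.mul hratio
  rw [mul_one] at hlim'
  have hev : ∀ᶠ m : ℕ in atTop,
      b < ({x : Fin d → ℤ | (((m + k : ℕ) : ℤ), x) ∈ Γ}.ncard : ℝ) / ((m + k : ℕ) : ℝ) ^ d := by
    filter_upwards [hlim'.eventually_const_lt hb, eventually_gt_atTop 0] with m hm hm0
    refine hm.trans_le ?_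
    have hmR : (0 : ℝ) < m := by exact_mod_cast hm0
    rw [div_pow, div_mul_div_cancel₀ (by positivity), Nat.cast_add (R := ℝ)]
    refine div_le_div_of_nonneg_right (Nat.cast_le.2 ?_) (by positivity : (0 : ℝ) ≤ (m + k) ^ d)
    refine Set.ncard_le_ncard_of_injOn (fun y => γ.2 + y) (fun y hy => ?_)
      (fun _ _ _ _ h => add_left_cancel h) (hfin _ (Nat.add_pos_left hm0 k).ne')
    obtain ⟨c, hc, hsum⟩ := exists_eq_sum_of_mem_convexHull_slopes G hy
    have := hcl (hcone ((m : ℤ), y) (fun g => m * c g)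
      (fun g hg => mul_nonneg hmR.le (hc g hg)) (by
        simp only [mul_smul, ← Finset.smul_sum, ← hsum]
        simp only [latticeEmb_apply, Prod.smul_mk, smul_inv_smul₀ hmR.ne', smul_eq_mul, mul_one,
          Int.cast_natCast]))
    have heq : γ + ((m : ℤ), y) = (((m + k : ℕ) : ℤ), γ.2 + y) :=
      Prod.ext (by simp [hk, add_comm]) rfl
    rwa [heq] at this
  filter_upwards [(tendsto_sub_atTop_nat k).eventually hev, eventually_ge_atTop k] with n hn hkn
  rwa [Nat.sub_add_cancel hkn] at hn

/-- A closed cone in the upper half-space which meets the boundary hyperplane only in `0` has a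
bounded slice at height one. -/
lemma isBounded_slice_of_inter_eq_zero {E : Type*} [NormedAddCommGroup E] [NormedSpace ℝ E]
    [FiniteDimensional ℝ E] {C : Set (ℝ × E)} (hclosed : IsClosed C)
    (hsmul : ∀ c : ℝ, 0 < c → ∀ p ∈ C, c • p ∈ C) (hnonneg : ∀ p ∈ C, 0 ≤ p.1)
    (hzero : ∀ p ∈ C, p.1 = 0 → p = 0) : Bornology.IsBounded {x : E | ((1 : ℝ), x) ∈ C} := by
  have hcpt : IsCompact (C ∩ Metric.sphere 0 1) := (isCompact_sphere _ _).inter_left hclosed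
  obtain ⟨ε, hε, hle⟩ : ∃ ε : ℝ, 0 < ε ∧ ∀ p ∈ C ∩ Metric.sphere 0 1, ε ≤ p.1 := by
    refine hcpt.exists_forall_le' continuous_fst.continuousOn fun p hp => ?_
    refine (hnonneg p hp.1).lt_of_ne fun h => ?_
    have hp1 : ‖p‖ = 1 := mem_sphere_zero_iff_norm.1 hp.2
    simp [hzero p hp.1 h.symm] at hp1
  refine isBounded_iff_forall_norm_le.2 ⟨ε⁻¹, fun x hx => ?_⟩
  have hpos : 0 < ‖((1 : ℝ), x)‖ := norm_pos_iff.2 fun h => one_ne_zero (congrArg Prod.fst h)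
  have h := hle (‖((1 : ℝ), x)‖⁻¹ • ((1 : ℝ), x)) ⟨hsmul _ (inv_pos.2 hpos) _ hx, by
    rw [mem_sphere_zero_iff_norm, norm_smul, norm_inv, norm_norm, inv_mul_cancel₀ hpos.ne']⟩
  simp only [Prod.smul_mk, smul_eq_mul, mul_one] at h
  exact (norm_snd_le ((1 : ℝ), x)).trans ((le_inv_comm₀ hε hpos).1 h)

/-- The slice at height one of a closed convex cone generated by vectors of height one is contained
in the closed convex hull of the generators. -/
lemma mem_closure_of_one_mk_mem_closure_hull {E : Type*} [NormedAddCommGroup E]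
    [NormedSpace ℝ E] {B : Set E} (hB : Convex ℝ B) {x : E}
    (hx : ((1 : ℝ), x) ∈ (ConvexCone.hull ℝ ({(1 : ℝ)} ×ˢ B)).closure) :
    x ∈ closure B := by
  have hcont : ContinuousAt (fun p : ℝ × E => p.1⁻¹ • p.2) ((1 : ℝ), x) :=
    (continuousAt_fst.inv₀ one_ne_zero).smul continuousAt_snd
  have := hcont.continuousWithinAt.mem_closure hx (t := B) (by
    rintro p hp
    obtain ⟨c, hc, y, hy, rfl⟩ :=
      (ConvexCone.mem_hull_of_convex ((convex_singleton (1 : ℝ)).prod hB)).1 hp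
    obtain ⟨h1, h2⟩ := hy
    simpa [Set.mem_singleton_iff.1 h1, smul_smul, hc.ne'] using h2)
  simpa using this

/-- The volume of the convex hull of the slopes of `Γ` is approximated from below by that of finite
subsets of `Γ` generating the lattice. -/
lemma exists_finset_lt_volume_convexHull_slopes {d : ℕ} {Γ : AddSubmonoid (ℤ × (Fin d → ℤ))}
    (ha : AddSubgroup.closure (Γ : Set (ℤ × (Fin d → ℤ))) = ⊤)
    (hbdd : Bornology.IsBounded (slopes (Γ : Set (ℤ × (Fin d → ℤ))))) {b : ℝ}
    (hb : b < (volume (convexHull ℝ (slopes (Γ : Set (ℤ × (Fin d → ℤ)))))).toReal) :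
    ∃ G : Finset (ℤ × (Fin d → ℤ)), (G : Set (ℤ × (Fin d → ℤ))) ⊆ Γ ∧
      AddSubgroup.closure (G : Set (ℤ × (Fin d → ℤ))) = ⊤ ∧
      b < (volume (convexHull ℝ (slopes (G : Set (ℤ × (Fin d → ℤ)))))).toReal := by
  classical
  obtain ⟨e, he⟩ := (Set.to_countable (Γ : Set (ℤ × (Fin d → ℤ)))).exists_eq_range
    ⟨0, Γ.zero_mem⟩
  let G : ℕ → Finset (ℤ × (Fin d → ℤ)) := fun n => (Finset.range n).image e
  have hmono : Monotone fun n => (G n : Set (ℤ × (Fin d → ℤ))) := fun m n hmn => by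
    simpa [G] using Set.image_mono (Set.Iio_subset_Iio hmn)
  have hunion : (Γ : Set (ℤ × (Fin d → ℤ))) = ⋃ n, (G n : Set (ℤ × (Fin d → ℤ))) := by
    rw [he]
    ext x
    simp only [Set.mem_range, Set.mem_iUnion, Finset.mem_coe, G, Finset.mem_image, Finset.mem_range]
    exact ⟨fun ⟨n, h⟩ => ⟨n + 1, n, n.lt_succ_self, h⟩, fun ⟨_, n, _, h⟩ => ⟨n, h⟩⟩
  have hsub : ∀ n, (G n : Set (ℤ × (Fin d → ℤ))) ⊆ Γ := fun n =>
    hunion ▸ Set.subset_iUnion (fun n => (G n : Set (ℤ × (Fin d → ℤ)))) n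
  have hDmono : Monotone fun n => convexHull ℝ (slopes (G n : Set (ℤ × (Fin d → ℤ)))) :=
    fun m n hmn => convexHull_mono (slopes_mono (hmono hmn))
  have hD : convexHull ℝ (slopes (Γ : Set (ℤ × (Fin d → ℤ)))) =
      ⋃ n, convexHull ℝ (slopes (G n : Set (ℤ × (Fin d → ℤ)))) := by
    refine Set.Subset.antisymm (convexHull_min ?_ (hDmono.directed_le.convex_iUnion
      fun _ => convex_convexHull ℝ _)) (Set.iUnion_subset fun n =>
        convexHull_mono (slopes_mono (hsub n)))
    rintro _ ⟨g, ⟨hg, hpos⟩, rfl⟩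
    obtain ⟨n, hn⟩ := Set.mem_iUnion.1 (hunion ▸ hg)
    exact Set.mem_iUnion.2 ⟨n, subset_convexHull ℝ _ ⟨g, ⟨hn, hpos⟩, rfl⟩⟩
  have hlim := tendsto_measure_iUnion_atTop (μ := volume) hDmono
  rw [← hD] at hlim
  have hlim' := (ENNReal.tendsto_toReal
    (isBounded_convexHull.2 hbdd).measure_lt_top.ne).comp hlim
  have hgen : ∀ᶠ n in atTop, AddSubgroup.closure (G n : Set (ℤ × (Fin d → ℤ))) = ⊤ := by
    have hfg : (⊤ : AddSubgroup (ℤ × (Fin d → ℤ))).FG := AddGroup.FG.out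
    obtain ⟨S, hS⟩ := hfg
    have hmem : ∀ s ∈ S, ∀ᶠ n in atTop,
        s ∈ AddSubgroup.closure (G n : Set (ℤ × (Fin d → ℤ))) := by
      intro s _
      have hs : s ∈ AddSubgroup.closure (Γ : Set (ℤ × (Fin d → ℤ))) :=
        ha ▸ AddSubgroup.mem_top s
      have hcmono : Monotone fun n => AddSubgroup.closure (G n : Set (ℤ × (Fin d → ℤ))) :=
        fun m n hmn => AddSubgroup.closure_mono (hmono hmn)
      rw [hunion, AddSubgroup.closure_iUnion,
        AddSubgroup.mem_iSup_of_directed hcmono.directed_le] at hs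
      obtain ⟨n, hn⟩ := hs
      exact eventually_atTop.2 ⟨n, fun m hm => hcmono hm hn⟩
    filter_upwards [(Filter.eventually_all_finset S).2 hmem] with n hn
    rw [eq_top_iff, ← hS]
    exact (AddSubgroup.closure_le _).2 hn
  obtain ⟨n, hn, hbn⟩ := (hgen.and (hlim'.eventually_const_lt hb)).exists
  exact ⟨G n, hsub n, hn, hbn⟩

theorem okounkov_body_volume_limit
    (d : ℕ) (hd : 1 ≤ d)
    (Γ : AddSubmonoid (ℤ × (Fin d → ℤ)))
    (hΓnat : ∀ γ ∈ Γ, 0 ≤ γ.1)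
    -- the embedding of `ℤ × ℤ^d` into `ℝ × ℝ^d`
    (emb : ℤ × (Fin d → ℤ) → ℝ × (Fin d → ℝ))
    (hemb : ∀ γ, emb γ = ((γ.1 : ℝ), fun i => (γ.2 i : ℝ)))
    -- `C(Γ)`, the smallest closed convex cone containing `Γ`
    (C : Set (ℝ × (Fin d → ℝ)))
    (hC : C = ⋂₀ {S : Set (ℝ × (Fin d → ℝ)) | emb '' (Γ : Set (ℤ × (Fin d → ℤ))) ⊆ S ∧
        IsClosed S ∧ Convex ℝ S ∧ ∀ c : ℝ, 0 < c → c • S ⊆ S})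
    -- the Okounkov body `Δ(Γ)`
    (Δ : Set (Fin d → ℝ)) (hΔ : Δ = {x : Fin d → ℝ | ((1 : ℝ), x) ∈ C})
    -- (a) `Γ` generates `ℤ × ℤ^d` as a group
    (ha : AddSubgroup.closure (Γ : Set (ℤ × (Fin d → ℤ))) = ⊤)
    -- (b) `C(Γ) ∩ ({0} × ℝ^d) = {0}`
    (hb : C ∩ {p : ℝ × (Fin d → ℝ) | p.1 = 0} = {(0 : ℝ × (Fin d → ℝ))}) :
    Tendsto
      (fun n : ℕ => (Set.ncard {x : Fin d → ℤ | ((n : ℤ), x) ∈ Γ} : ℝ) / (n : ℝ) ^ d)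
      atTop (nhds (volume Δ).toReal) := by
  obtain rfl : emb = latticeEmb d := funext hemb
  have hCmin : ∀ S : Set (ℝ × (Fin d → ℝ)), (∀ γ ∈ Γ, latticeEmb d γ ∈ S) → IsClosed S →
      Convex ℝ S → (∀ c : ℝ, 0 < c → ∀ p ∈ S, c • p ∈ S) → C ⊆ S := fun S h1 h2 h3 h4 =>
    hC ▸ Set.sInter_subset_of_mem ⟨Set.image_subset_iff.2 h1, h2, h3,
      fun c hc => Set.smul_set_subset_iff.2 fun p hp => h4 c hc p hp⟩
  have hΓC : ∀ γ ∈ Γ, latticeEmb d γ ∈ C := fun γ hγ =>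
    hC ▸ Set.mem_sInter.2 fun S hS => hS.1 (Set.mem_image_of_mem _ hγ)
  have hclosed : IsClosed C := hC ▸ isClosed_sInter fun S hS => hS.2.1
  have hconv : Convex ℝ C := hC ▸ convex_sInter fun S hS => hS.2.2.1
  have hsmul : ∀ c : ℝ, 0 < c → ∀ p ∈ C, c • p ∈ C := fun c hc p hp => by
    rw [hC] at hp ⊢
    exact Set.mem_sInter.2 fun S hS =>
      hS.2.2.2 c hc (Set.smul_mem_smul_set (Set.mem_sInter.1 hp S hS))
  have hnonneg : ∀ p ∈ C, 0 ≤ p.1 := hCmin {p | 0 ≤ p.1}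
    (fun γ hγ => Int.cast_nonneg (R := ℝ) (hΓnat γ hγ)) (isClosed_le continuous_const continuous_fst)
    (convex_halfSpace_ge (LinearMap.fst ℝ ℝ (Fin d → ℝ)).isLinear 0)
    (fun c hc p hp => mul_nonneg hc.le hp)
  have hzero : ∀ p ∈ C, p.1 = 0 → p = 0 := fun p hp h0 => by
    have : p ∈ C ∩ {p : ℝ × (Fin d → ℝ) | p.1 = 0} := ⟨hp, h0⟩
    rwa [hb] at this
  have hbdd : Bornology.IsBounded Δ :=
    hΔ ▸ isBounded_slice_of_inter_eq_zero hclosed hsmul hnonneg hzero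
  have hΔclosed : IsClosed Δ := hΔ ▸ hclosed.preimage (by fun_prop)
  have hΔconv : Convex ℝ Δ := by
    rw [hΔ]
    intro x hx y hy a b ha hb hab
    have := hconv hx hy ha hb hab
    simpa [hab] using this
  have hslopes : slopes (Γ : Set (ℤ × (Fin d → ℤ))) ⊆ Δ := by
    rintro _ ⟨g, ⟨hg, hpos⟩, rfl⟩
    rw [hΔ, Set.mem_ofPred_eq, one_mk_inv_smul g hpos]
    exact hsmul _ (inv_pos.2 (Int.cast_pos.2 hpos)) _ (hΓC g hg)
  have hlevel : ∀ n : ℕ, n ≠ 0 → {x : Fin d → ℤ | ((n : ℤ), x) ∈ Γ} ⊆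
      {y : Fin d → ℤ | (n : ℝ)⁻¹ • (fun i => (y i : ℝ)) ∈ Δ} := fun n hn x hx =>
    hslopes ⟨((n : ℤ), x), ⟨hx, by simpa using Nat.pos_of_ne_zero hn⟩, by simp⟩
  set D := convexHull ℝ (slopes (Γ : Set (ℤ × (Fin d → ℤ)))) with hD
  have hne : (slopes (Γ : Set (ℤ × (Fin d → ℤ)))).Nonempty := by
    by_contra hempty
    have hle : AddSubgroup.closure (Γ : Set (ℤ × (Fin d → ℤ))) ≤
        (AddMonoidHom.fst ℤ (Fin d → ℤ)).ker := (AddSubgroup.closure_le _).2 fun γ hγ =>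
      (not_lt.1 fun h => hempty ⟨_, γ, ⟨hγ, h⟩, rfl⟩).antisymm (hΓnat γ hγ)
    rw [ha] at hle
    exact one_ne_zero (hle (AddSubgroup.mem_top ((1 : ℤ), (0 : Fin d → ℤ))))
  have hΔsub : Δ ⊆ closure D := by
    intro x hx
    refine mem_closure_of_one_mk_mem_closure_hull (convex_convexHull ℝ _) ?_
    rw [hΔ] at hx
    set K := ConvexCone.hull ℝ ({(1 : ℝ)} ×ˢ D)
    have hmemK : ∀ z ∈ D, ((1 : ℝ), z) ∈ K := fun z hz =>
      ConvexCone.subset_hull ⟨rfl, hz⟩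
    have hKpt : K.closure.Pointed := by
      obtain ⟨z, hz⟩ := hne
      exact ConvexCone.Pointed.of_nonempty_of_isClosed
        ⟨_, subset_closure (hmemK z (subset_convexHull ℝ _ hz))⟩ isClosed_closure
    refine hCmin (K.closure : Set (ℝ × (Fin d → ℝ))) (fun γ hγ => ?_) isClosed_closure
      K.closure.convex (fun c hc p hp => K.closure.smul_mem hc hp) hx
    rcases (hΓnat γ hγ).eq_or_lt with h0 | hpos
    · rw [hzero _ (hΓC γ hγ) (by rw [latticeEmb_apply, ← h0, Int.cast_zero])]
      exact hKpt
    · refine subset_closure ?_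
      have hR : (0 : ℝ) < γ.1 := Int.cast_pos.2 hpos
      have := K.smul_mem hR (hmemK _ (subset_convexHull ℝ _ ⟨γ, ⟨hγ, hpos⟩, rfl⟩))
      rwa [one_mk_inv_smul γ hpos, smul_inv_smul₀ hR.ne'] at this
  have hvol : volume Δ = volume D := by
    refine le_antisymm ((measure_mono hΔsub).trans_eq ?_)
      (measure_mono (convexHull_min hslopes hΔconv))
    exact measure_closure_of_null_frontier ((convex_convexHull ℝ _).addHaar_frontier volume)
  refine tendsto_order.2 ⟨fun b hbv => ?_, fun b hbv => ?_⟩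
  · rw [hvol] at hbv
    obtain ⟨G, hGΓ, hG, hbG⟩ :=
      exists_finset_lt_volume_convexHull_slopes ha (hbdd.subset hslopes) hbv
    exact eventually_lt_ncard_div_pow hΓnat
      (fun n hn => (finite_setOf_inv_smul_mem hbdd hn).subset (hlevel n hn)) hGΓ hG hbG
  · have hup := tendsto_ncard_inv_smul_mem_div_pow hbdd hΔclosed.measurableSet
      (hΔconv.addHaar_frontier volume)
    filter_upwards [hup.eventually_lt_const hbv, eventually_ne_atTop 0] with n hn hn0
    refine lt_of_le_of_lt ?_ hn
    exact div_le_div_of_nonneg_right (Nat.cast_le.2 (Set.ncard_le_ncard (hlevel n hn0)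
      (finite_setOf_inv_smul_mem hbdd hn0))) (by positivity)
end

section
/- Let d ≥ 1 and let Γ be an additive submonoid of ℕ × ℤ^d. Let C(Γ) be the smallest closed convex cone in ℝ × ℝ^d containing Γ, and let Δ(Γ) = {x ∈ ℝ^d : (1, x) ∈ C(Γ)} be the Okounkov body of Γ. Assume (a) the subgroup of ℤ × ℤ^d generated by Γ is all of ℤ × ℤ^d, and (b) C(Γ) ∩ ({0} × ℝ^d) = {(0,0)} (so that Δ(Γ) is a compact convex set and each slice Γ ∩ ({k} × ℤ^d) is finite). Let F : ℝ^d → ℝ be a polynomial function of degree n and let f be its homogeneous component of degree n. Then the limit as k → ∞ of k^{-(n+d)} · Σ_{x ∈ ℤ^d, (k,x) ∈ Γ} F(x) exists and equals ∫_{Δ(Γ)} f(x) dx, the integral taken with respect to d-dimensional Lebesgue measure. -/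
open Filter MeasureTheory Pointwise
open scoped NNReal

/-- If a submonoid generates a commutative group, every element of the group is a difference of
two elements of the submonoid. -/
theorem AddSubmonoid.exists_add_mem_of_closure_eq_top {A : Type*} [AddCommGroup A]
    (Γ : AddSubmonoid A) (hΓ : AddSubgroup.closure (Γ : Set A) = ⊤) (z : A) :
    ∃ b ∈ Γ, z + b ∈ Γ := by
  have hz : z ∈ AddSubgroup.closure (Γ : Set A) := hΓ ▸ AddSubgroup.mem_top z
  induction hz using AddSubgroup.closure_induction with
  | mem x hx => exact ⟨0, Γ.zero_mem, by simpa using hx⟩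
  | zero => exact ⟨0, Γ.zero_mem, by simp⟩
  | add x y _ _ hx hy =>
    obtain ⟨b, hb, hxb⟩ := hx
    obtain ⟨c, hc, hyc⟩ := hy
    exact ⟨b + c, Γ.add_mem hb hc, by simpa only [add_add_add_comm] using Γ.add_mem hxb hyc⟩
  | neg x _ hx =>
    obtain ⟨b, hb, hxb⟩ := hx
    exact ⟨x + b, hxb, by simpa using hb⟩

/-- Finitely many elements of a commutative group can be moved into a generating submonoid by a
common translation. -/
theorem AddSubmonoid.exists_forall_add_mem_of_finite {A : Type*} [AddCommGroup A]
    (Γ : AddSubmonoid A) (hΓ : AddSubgroup.closure (Γ : Set A) = ⊤) {R : Set A} (hR : R.Finite) :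
    ∃ γ ∈ Γ, ∀ r ∈ R, r + γ ∈ Γ := by
  induction R, hR using Set.Finite.induction_on with
  | empty => exact ⟨0, Γ.zero_mem, by simp⟩
  | @insert a R _ _ ih =>
    obtain ⟨γ, hγ, hRγ⟩ := ih
    obtain ⟨b, hb, hab⟩ := Γ.exists_add_mem_of_closure_eq_top hΓ a
    refine ⟨b + γ, Γ.add_mem hb hγ, ?_⟩
    rintro r (rfl | hr)
    · simpa only [add_assoc] using Γ.add_mem hab hγ
    · simpa only [add_left_comm] using Γ.add_mem hb (hRγ r hr)

/-- The lattice points of a finitely generated subcone of the cone over a generating submonoid can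
be moved into the submonoid by a common translation. -/
theorem AddSubmonoid.exists_forall_add_mem_of_mem_span {A V : Type*} [AddCommGroup A]
    [NormedAddCommGroup V] [NormedSpace ℝ V]
    (Γ : AddSubmonoid A) (hΓ : AddSubgroup.closure (Γ : Set A) = ⊤) (e : A →+ V)
    (he : ∀ r : ℝ, {z | ‖e z‖ ≤ r}.Finite) {S : Finset A} (hS : (S : Set A) ⊆ Γ) :
    ∃ γ ∈ Γ, ∀ z, e z ∈ Submodule.span ℝ≥0 (e '' S) → z + γ ∈ Γ := by
  obtain ⟨γ, hγ, hR⟩ := Γ.exists_forall_add_mem_of_finite hΓ (he (∑ s ∈ S, ‖e s‖))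
  refine ⟨γ, hγ, fun z hz => ?_⟩
  obtain ⟨c, hc⟩ := (Submodule.mem_span_image_finset_iff_exists_fun' ℝ≥0).1 hz
  have hw : ∑ s ∈ S, ⌊c s⌋₊ • s ∈ Γ := Γ.sum_mem fun s hs => Γ.nsmul_mem (hS hs) _
  have hr : e (z - ∑ s ∈ S, ⌊c s⌋₊ • s) = ∑ s ∈ S, ((c s : ℝ) - ⌊c s⌋₊) • e s := by
    rw [map_sub, ← hc, map_sum, ← Finset.sum_sub_distrib]
    refine Finset.sum_congr rfl fun s _ => ?_
    rw [map_nsmul, sub_smul, NNReal.smul_def, Nat.cast_smul_eq_nsmul]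
  have hz' := hR (z - ∑ s ∈ S, ⌊c s⌋₊ • s) <| by
    rw [Set.mem_ofPred_eq, hr]
    refine (norm_sum_le _ _).trans (Finset.sum_le_sum fun s _ => ?_)
    rw [norm_smul]
    refine mul_le_of_le_one_left (norm_nonneg _) ?_
    have h1 : ((⌊c s⌋₊ : ℝ≥0) : ℝ) ≤ c s := NNReal.coe_le_coe.2 (Nat.floor_le zero_le)
    have h2 : (c s : ℝ) < ((⌊c s⌋₊ + 1 : ℝ≥0) : ℝ) := NNReal.coe_lt_coe.2 (Nat.lt_floor_add_one _)
    push_cast at h1 h2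
    rw [Real.norm_eq_abs, abs_le]
    constructor <;> linarith
  convert Γ.add_mem hz' hw using 1
  abel

theorem Submodule.convex_nnreal {V : Type*} [AddCommGroup V] [Module ℝ V]
    (H : Submodule ℝ≥0 V) : Convex ℝ (H : Set V) := by
  intro x hx y hy a b ha hb _
  exact H.add_mem (H.smul_mem ⟨a, ha⟩ hx) (H.smul_mem ⟨b, hb⟩ hy)

theorem Submodule.exists_finset_subset_span_image {R M A : Type*} [Semiring R] [AddCommMonoid M]
    [Module R M] (e : A → M) {Γ : Set A} {u : Set M} (hu : u.Finite)
    (h : u ⊆ Submodule.span R (e '' Γ)) :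
    ∃ S : Finset A, (S : Set A) ⊆ Γ ∧ u ⊆ Submodule.span R (e '' S) := by
  classical
  induction u, hu using Set.Finite.induction_on with
  | empty => exact ⟨∅, by simp, by simp⟩
  | @insert a u _ _ ih =>
    rw [Set.insert_subset_iff] at h
    obtain ⟨S, hS, huS⟩ := ih h.2
    obtain ⟨T, hT, haT⟩ := Submodule.mem_span_finite_of_mem_span h.1
    obtain ⟨S', hS', rfl⟩ := Finset.subset_set_image_iff.1 hT
    refine ⟨S' ∪ S, by simp [hS, hS'], Set.insert_subset ?_ (huS.trans ?_)⟩
    · refine Submodule.span_mono ?_ haT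
      rw [Finset.coe_image]
      gcongr; simp
    · refine Submodule.span_mono ?_
      gcongr; simp

/-- Large lattice points whose rescaling lies in a compact convex part of the interior of the cone
over a generating submonoid belong to that submonoid. -/
theorem AddSubmonoid.eventually_mem_of_inv_smul_mem {A V : Type*} [AddCommGroup A]
    [NormedAddCommGroup V] [NormedSpace ℝ V] [FiniteDimensional ℝ V]
    (Γ : AddSubmonoid A) (hΓ : AddSubgroup.closure (Γ : Set A) = ⊤) (e : A →+ V)
    (he : ∀ r : ℝ, {z | ‖e z‖ ≤ r}.Finite) {L : Set V} (hL : IsCompact L) (hLc : Convex ℝ L)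
    (hLH : L ⊆ interior (Submodule.span ℝ≥0 (e '' Γ) : Set V)) :
    ∀ᶠ K : ℕ in atTop, ∀ z : A, (K : ℝ)⁻¹ • e z ∈ L → z ∈ Γ := by
  obtain ⟨u, hLu, huH⟩ := hLc.exists_subset_interior_convexHull_finset_of_isCompact hL
    (subset_interior_iff_mem_nhdsSet.1 hLH)
  obtain ⟨S, hS, huS⟩ := Submodule.exists_finset_subset_span_image e u.finite_toSet
    ((subset_convexHull ℝ _).trans huH)
  obtain ⟨γ, -, hγ⟩ := Γ.exists_forall_add_mem_of_mem_span hΓ e he hS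
  obtain ⟨δ, hδ, hδL⟩ := hL.exists_thickening_subset_open isOpen_interior hLu
  have hlim : Tendsto (fun K : ℕ => ‖(K : ℝ)⁻¹ • e γ‖) atTop (nhds 0) := by
    simpa using ((tendsto_inv_atTop_nhds_zero_nat (𝕜 := ℝ)).smul_const (e γ)).norm
  filter_upwards [hlim.eventually_lt_const hδ, eventually_gt_atTop 0] with K hK hK0 z hz
  have hmem : (K : ℝ)⁻¹ • e (z - γ) ∈ Submodule.span ℝ≥0 (e '' S) := by
    refine convexHull_min huS (Submodule.convex_nnreal _) (interior_subset (hδL ?_))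
    refine Metric.mem_thickening_iff.2 ⟨_, hz, ?_⟩
    rwa [map_sub, smul_sub, dist_eq_norm, sub_sub_cancel_left, norm_neg]
  have hK' := (Submodule.span ℝ≥0 (e '' S)).smul_mem (K : ℝ≥0) hmem
  rw [NNReal.smul_def, NNReal.coe_natCast, smul_inv_smul₀ (by positivity)] at hK'
  simpa using hγ _ hK'

theorem AddSubmonoid.interior_span_nnreal_nonempty {A V : Type*} [AddCommGroup A]
    [NormedAddCommGroup V] [NormedSpace ℝ V] [FiniteDimensional ℝ V]
    (Γ : AddSubmonoid A) (hΓ : AddSubgroup.closure (Γ : Set A) = ⊤) (e : A →+ V)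
    (he : Submodule.span ℝ (Set.range e) = ⊤) :
    (interior (Submodule.span ℝ≥0 (e '' Γ) : Set V)).Nonempty := by
  rw [(Submodule.convex_nnreal _).interior_nonempty_iff_affineSpan_eq_top,
    AffineSubspace.affineSpan_eq_top_iff_vectorSpan_eq_top_of_nonempty ℝ V V ⟨0, zero_mem _⟩,
    eq_top_iff, ← he, Submodule.span_le]
  rintro _ ⟨z, rfl⟩
  obtain ⟨b, hb, hzb⟩ := Γ.exists_add_mem_of_closure_eq_top hΓ z
  have := vsub_mem_vectorSpan ℝ (Submodule.subset_span (R := ℝ≥0) (Set.mem_image_of_mem e hzb))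
    (Submodule.subset_span (R := ℝ≥0) (Set.mem_image_of_mem e hb))
  simpa using this

theorem IsCompact.exists_finite_subset_convexHull {V : Type*} [NormedAddCommGroup V]
    [NormedSpace ℝ V] [FiniteDimensional ℝ V] {L U : Set V} (hL : IsCompact L) (hU : IsOpen U)
    (hLU : L ⊆ U) : ∃ u : Set V, u.Finite ∧ u ⊆ U ∧ L ⊆ convexHull ℝ u := by
  refine hL.induction_on (p := fun L => ∃ u : Set V, u.Finite ∧ u ⊆ U ∧ L ⊆ convexHull ℝ u)
    ⟨∅, by simp⟩ (fun s t hst ⟨u, hu, huU, htu⟩ => ⟨u, hu, huU, hst.trans htu⟩) ?_ ?_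
  · rintro s t ⟨u, hu, huU, hsu⟩ ⟨v, hv, hvU, htv⟩
    exact ⟨u ∪ v, hu.union hv, Set.union_subset huU hvU, Set.union_subset
      (hsu.trans (convexHull_mono Set.subset_union_left))
      (htv.trans (convexHull_mono Set.subset_union_right))⟩
  · intro x hx
    obtain ⟨b, hxb, hbU⟩ := exists_mem_interior_convexHull_affineBasis (hU.mem_nhds (hLU hx))
    exact ⟨convexHull ℝ (Set.range b), mem_nhdsWithin_of_mem_nhds (mem_interior_iff_mem_nhds.1 hxb),
      Set.range b, Set.finite_range b, (subset_convexHull ℝ _).trans hbU, subset_rfl⟩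

/-- A convex set of finite measure is approximated in measure by compact convex subsets of its
interior. -/
theorem Convex.exists_isCompact_subset_interior_measureReal_lt {V : Type*} [NormedAddCommGroup V]
    [NormedSpace ℝ V] [FiniteDimensional ℝ V] [MeasurableSpace V] [BorelSpace V] (μ : Measure V)
    [μ.IsAddHaarMeasure] {s : Set V} (hs : Convex ℝ s) (hμ : μ s ≠ ⊤) {ε : ℝ} (hε : 0 < ε) :
    ∃ L ⊆ interior s, IsCompact L ∧ Convex ℝ L ∧ μ.real s < μ.real L + ε := by
  have hint : μ (interior s) = μ s := by
    refine le_antisymm (measure_mono interior_subset) ?_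
    calc μ s ≤ μ (interior s ∪ frontier s) :=
          measure_mono (subset_closure.trans (closure_eq_interior_union_frontier s).subset)
      _ ≤ μ (interior s) + μ (frontier s) := measure_union_le _ _
      _ = μ (interior s) := by rw [hs.addHaar_frontier μ, add_zero]
  obtain ⟨L, hLs, hL, hlt⟩ := isOpen_interior.measurableSet.exists_isCompact_lt_add
    (hint ▸ hμ) (ENNReal.ofReal_pos.2 hε).ne'
  obtain ⟨u, hu, hus, hLu⟩ := hL.exists_finite_subset_convexHull isOpen_interior hLs
  have hcomp : IsCompact (convexHull ℝ u) := hu.isCompact_convexHull ℝ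
  refine ⟨convexHull ℝ u, convexHull_min hus hs.interior, hcomp, convex_convexHull ℝ u, ?_⟩
  have h := (hint ▸ hlt).trans_le (add_le_add_left (measure_mono hLu) _)
  have h' := (ENNReal.toReal_lt_toReal hμ
    (ENNReal.add_ne_top.2 ⟨hcomp.measure_ne_top, ENNReal.ofReal_ne_top⟩)).2 h
  rwa [ENNReal.toReal_add hcomp.measure_ne_top ENNReal.ofReal_ne_top,
    ENNReal.toReal_ofReal hε.le] at h'

/-- The lattice point `x` rescaled by `1 / K`. -/
noncomputable def rescaledPoint {ι : Type*} (K : ℕ) (x : ι → ℤ) : ι → ℝ :=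
  (K : ℝ)⁻¹ • fun i => (x i : ℝ)

theorem rescaledPoint_injective {ι : Type*} {K : ℕ} (hK : K ≠ 0) :
    Function.Injective (rescaledPoint K : (ι → ℤ) → ι → ℝ) := by
  intro x y h
  funext i
  have hi := congrFun (smul_right_injective _ (inv_ne_zero (Nat.cast_ne_zero.2 hK)) h) i
  exact_mod_cast hi

theorem range_rescaledPoint {ι : Type*} [Finite ι] {K : ℕ} (hK : K ≠ 0) :
    Set.range (rescaledPoint K : (ι → ℤ) → ι → ℝ) =
      (K : ℝ)⁻¹ • (Submodule.span ℤ (Set.range (Pi.basisFun ℝ ι)) : Set (ι → ℝ)) := by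
  have : NeZero K := ⟨hK⟩
  have hK' : (K : ℝ) ≠ 0 := Nat.cast_ne_zero.2 hK
  ext v
  rw [← Submodule.coe_pointwise_smul, SetLike.mem_coe, BoxIntegral.unitPartition.mem_smul_span_iff]
  constructor
  · rintro ⟨x, rfl⟩ i
    exact ⟨x i, by simp [rescaledPoint, hK']⟩
  · intro h
    choose x hx using h
    refine ⟨x, funext fun i => ?_⟩
    have := hx i
    simp only [algebraMap_int_eq, eq_intCast] at this
    simp [rescaledPoint, this, hK']

theorem finite_preimage_rescaledPoint {ι : Type*} [Fintype ι] {K : ℕ} (hK : K ≠ 0)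
    {s : Set (ι → ℝ)} (hs : Bornology.IsBounded s) : (rescaledPoint K ⁻¹' s).Finite := by
  have hfin : (s ∩ Set.range (rescaledPoint K : (ι → ℤ) → ι → ℝ)).Finite := by
    rw [range_rescaledPoint hK, ← Submodule.coe_pointwise_smul,
      ZSpan.smul _ (inv_ne_zero (Nat.cast_ne_zero.2 hK))]
    exact ZSpan.setFinite_inter _ hs
  rw [← Set.preimage_inter_range]
  exact hfin.preimage (rescaledPoint_injective hK).injOn

/-- Convergence of Riemann sums over the lattice points of the dilates of a bounded set. -/
theorem tendsto_finsum_rescaledPoint {ι : Type*} [Fintype ι] {s : Set (ι → ℝ)}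
    (hs : Bornology.IsBounded s) (hsm : MeasurableSet s) (hsf : volume (frontier s) = 0)
    {G : (ι → ℝ) → ℝ} (hG : Continuous G) :
    Tendsto (fun K : ℕ => (∑ᶠ x ∈ rescaledPoint K ⁻¹' s, G (rescaledPoint K x)) /
      (K : ℝ) ^ Fintype.card ι) atTop (nhds (∫ x in s, G x)) := by
  refine (tendsto_tsum_div_pow_atTop_integral s G hG hs hsm hsf).congr' ?_
  filter_upwards [eventually_ne_atTop 0] with K hK
  congr 1
  have hfin := finite_preimage_rescaledPoint hK hs
  have himg : rescaledPoint K '' (rescaledPoint K ⁻¹' s) =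
      s ∩ (K : ℝ)⁻¹ • (Submodule.span ℤ (Set.range (Pi.basisFun ℝ ι)) : Set (ι → ℝ)) := by
    rw [Set.image_preimage_eq_inter_range, range_rescaledPoint hK]
  have : Finite ↑(s ∩ (K : ℝ)⁻¹ • (Submodule.span ℤ (Set.range (Pi.basisFun ℝ ι)) :
      Set (ι → ℝ))) := himg ▸ (hfin.image _).to_subtype
  rw [← finsum_mem_image (f := G) (rescaledPoint_injective hK).injOn, himg,
    ← finsum_set_coe_eq_finsum_mem, tsum_eq_finsum (Set.toFinite _)]

theorem norm_finsum_mem_sub_le {α : Type*} {A B D : Set α} (hA : A.Finite) (hBA : B ⊆ A)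
    (hDB : D ⊆ B) {g : α → ℝ} {M : ℝ} (hg : ∀ x ∈ A, ‖g x‖ ≤ M) :
    ‖∑ᶠ x ∈ A, g x - ∑ᶠ x ∈ B, g x‖ ≤ M * (∑ᶠ x ∈ A, (1 : ℝ) - ∑ᶠ x ∈ D, (1 : ℝ)) := by
  have hdiff : ∀ {E : Set α} (_ : E ⊆ A) (h : α → ℝ),
      ∑ᶠ x ∈ A, h x - ∑ᶠ x ∈ E, h x = ∑ x ∈ (hA.sdiff (t := E)).toFinset, h x := fun hE h => by
    rw [← finsum_mem_add_sdiff hE hA, add_sub_cancel_left,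
      finsum_mem_eq_finite_toFinset_sum _ hA.sdiff]
  rw [hdiff hBA, hdiff (hDB.trans hBA), Finset.mul_sum, mul_one]
  have hMA : ∀ x ∈ A, 0 ≤ M := fun x hx => (norm_nonneg _).trans (hg x hx)
  calc _ ≤ ∑ x ∈ (hA.sdiff (t := B)).toFinset, M :=
        norm_sum_le_of_le _ fun x hx => hg x (by simp at hx; exact hx.1)
    _ ≤ _ := by
      refine Finset.sum_le_sum_of_subset_of_nonneg ?_ fun x hx _ => hMA x (by simp at hx; exact hx.1)
      rw [Set.Finite.toFinset_subset_toFinset]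
      gcongr

/-- Riemann sums over sets of lattice points that lie in the dilates of a bounded convex set `Δ`
and eventually exhaust the dilates of every compact convex subset of its interior. -/
theorem tendsto_finsum_rescaledPoint_of_exhausts {ι : Type*} [Fintype ι] {Δ : Set (ι → ℝ)}
    (hΔ : IsCompact Δ) (hΔc : Convex ℝ Δ) {Λ : ℕ → Set (ι → ℤ)}
    (hΛ : ∀ K ≠ 0, Λ K ⊆ rescaledPoint K ⁻¹' Δ)
    (hL : ∀ L ⊆ interior Δ, IsCompact L → Convex ℝ L →
      ∀ᶠ K in atTop, rescaledPoint K ⁻¹' L ⊆ Λ K)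
    {G : (ι → ℝ) → ℝ} (hG : Continuous G) :
    Tendsto (fun K : ℕ => (∑ᶠ x ∈ Λ K, G (rescaledPoint K x)) / (K : ℝ) ^ Fintype.card ι)
      atTop (nhds (∫ x in Δ, G x)) := by
  have key : ∀ {s : Set (ι → ℝ)}, IsCompact s → Convex ℝ s → ∀ {G : (ι → ℝ) → ℝ}, Continuous G →
      Tendsto (fun K : ℕ => (∑ᶠ x ∈ rescaledPoint K ⁻¹' s, G (rescaledPoint K x)) /
      (K : ℝ) ^ Fintype.card ι) atTop (nhds (∫ x in s, G x)) := fun hs hsc _ hG =>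
    tendsto_finsum_rescaledPoint hs.isBounded hs.isClosed.measurableSet
      (hsc.addHaar_frontier volume) hG
  refine (tendsto_iff_of_dist ?_).1 (key hΔ hΔc hG)
  obtain ⟨M, hM⟩ := hΔ.exists_bound_of_continuousOn hG.continuousOn
  obtain ⟨B, hB0, hB⟩ : ∃ B : ℝ, 0 < B ∧ ∀ x ∈ Δ, ‖G x‖ ≤ B :=
    ⟨max M 1, by positivity, fun x hx => (hM x hx).trans (le_max_left _ _)⟩
  refine Metric.tendsto_nhds.2 fun ε hε => ?_
  obtain ⟨L, hLΔ, hLc, hLconv, hvol⟩ := hΔc.exists_isCompact_subset_interior_measureReal_lt volume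
    hΔ.measure_ne_top (div_pos hε hB0)
  have hlim := ((key hΔ hΔc (continuous_const (y := (1 : ℝ)))).sub
    (key hLc hLconv (continuous_const (y := (1 : ℝ))))).const_mul B
  have hlt : B * ((∫ _ in Δ, (1 : ℝ)) - ∫ _ in L, (1 : ℝ)) < ε := by
    rw [setIntegral_const, setIntegral_const, smul_eq_mul, smul_eq_mul, mul_one, mul_one,
      ← lt_div_iff₀' hB0]
    linarith
  filter_upwards [hlim.eventually_lt_const hlt, hL L hLΔ hLc hLconv, eventually_ne_atTop 0]
    with K hK hLK hK0
  rw [dist_zero_right, Real.norm_eq_abs, abs_of_nonneg dist_nonneg, dist_eq_norm]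
  refine lt_of_le_of_lt ?_ hK
  rw [← sub_div, ← sub_div, mul_div_assoc', norm_div, norm_pow, Real.norm_natCast]
  gcongr
  exact norm_finsum_mem_sub_le (finite_preimage_rescaledPoint hK0 hΔ.isBounded) (hΛ K hK0) hLK
    fun x hx => hB _ hx

theorem MvPolynomial.IsHomogeneous.eval_smul {σ R : Type*} [Fintype σ] [CommSemiring R]
    {P : MvPolynomial σ R} {j : ℕ} (hP : P.IsHomogeneous j) (c : R) (x : σ → R) :
    MvPolynomial.eval (c • x) P = c ^ j * MvPolynomial.eval x P := by
  rw [MvPolynomial.eval_eq', MvPolynomial.eval_eq', Finset.mul_sum]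
  refine Finset.sum_congr rfl fun m hm => ?_
  have hdeg : ∑ i, m i = j := by
    rw [← hP (MvPolynomial.mem_support_iff.1 hm), Finsupp.weight_apply]
    simp [Finsupp.sum_fintype]
  simp only [Pi.smul_apply, smul_eq_mul, mul_pow, Finset.prod_mul_distrib,
    Finset.prod_pow_eq_pow_sum, hdeg]
  ring

/-- Only the top homogeneous component of a polynomial contributes to the limit of its rescaled
sums over sets of lattice points. -/
theorem tendsto_finsum_eval_div_pow {ι : Type*} [Fintype ι] {Λ : ℕ → Set (ι → ℤ)}
    (hΛ : ∀ K ≠ 0, (Λ K).Finite) {I : ((ι → ℝ) → ℝ) → ℝ}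
    (h : ∀ G : (ι → ℝ) → ℝ, Continuous G →
      Tendsto (fun K : ℕ => (∑ᶠ x ∈ Λ K, G (rescaledPoint K x)) / (K : ℝ) ^ Fintype.card ι)
        atTop (nhds (I G)))
    (F : MvPolynomial ι ℝ) :
    Tendsto (fun K : ℕ => (∑ᶠ x ∈ Λ K, MvPolynomial.eval (fun i => (x i : ℝ)) F) /
        (K : ℝ) ^ (F.totalDegree + Fintype.card ι)) atTop
      (nhds (I fun x => MvPolynomial.eval x (MvPolynomial.homogeneousComponent F.totalDegree F))) := by
  set n := F.totalDegree
  let c (j : ℕ) := MvPolynomial.homogeneousComponent j F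
  have hlow : Tendsto (fun K : ℕ => ∑ j ∈ Finset.range n, ((K : ℝ)⁻¹) ^ (n - j) *
      ((∑ᶠ x ∈ Λ K, MvPolynomial.eval (rescaledPoint K x) (c j)) / (K : ℝ) ^ Fintype.card ι))
      atTop (nhds 0) := by
    rw [← Finset.sum_const_zero (s := Finset.range n)]
    refine tendsto_finsetSum _ fun j hj => ?_
    have h0 : Tendsto (fun K : ℕ => ((K : ℝ)⁻¹) ^ (n - j)) atTop (nhds 0) := by
      have := (tendsto_inv_atTop_nhds_zero_nat (𝕜 := ℝ)).pow (n - j)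
      rwa [zero_pow (Nat.sub_ne_zero_of_lt (Finset.mem_range.1 hj))] at this
    simpa using h0.mul (h _ (MvPolynomial.continuous_eval (c j)))
  have hsum := hlow.add (h _ (MvPolynomial.continuous_eval (c n)))
  rw [zero_add] at hsum
  refine hsum.congr' ?_
  filter_upwards [eventually_ne_atTop 0] with K hK
  have hK' : (K : ℝ) ≠ 0 := Nat.cast_ne_zero.2 hK
  have heval : ∀ x : ι → ℤ, MvPolynomial.eval (fun i => (x i : ℝ)) F =
      ∑ j ∈ Finset.range (n + 1), (K : ℝ) ^ j * MvPolynomial.eval (rescaledPoint K x) (c j) := by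
    intro x
    conv_lhs => rw [← MvPolynomial.sum_homogeneousComponent F, map_sum]
    refine Finset.sum_congr rfl fun j _ => ?_
    rw [← (MvPolynomial.homogeneousComponent_isHomogeneous j F).eval_smul, rescaledPoint,
      smul_inv_smul₀ hK']
  simp only [heval, fun g : (ι → ℤ) → ℝ => finsum_mem_eq_finite_toFinset_sum g (hΛ K hK)]
  rw [Finset.sum_comm, Finset.sum_range_succ, add_div, Finset.sum_div (Finset.range n)]
  congr 1
  · refine Finset.sum_congr rfl fun j hj => ?_
    rw [← Finset.mul_sum, pow_add, inv_pow, pow_sub₀ _ hK' (Finset.mem_range.1 hj).le,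
      mul_inv, inv_inv]
    ring
  · rw [← Finset.mul_sum, pow_add, mul_div_mul_left _ _ (pow_ne_zero _ hK')]

/-- The embedding of `ℤ × ℤ^ι` into `ℝ × ℝ^ι`. -/
def latticeEmbedding (ι : Type*) : ℤ × (ι → ℤ) →+ ℝ × (ι → ℝ) :=
  (Int.castAddHom ℝ).prodMap ((Int.castAddHom ℝ).compLeft ι)

theorem latticeEmbedding_apply {ι : Type*} (z : ℤ × (ι → ℤ)) :
    latticeEmbedding ι z = ((z.1 : ℝ), fun i => (z.2 i : ℝ)) := rfl

theorem finite_norm_latticeEmbedding_le {ι : Type*} [Fintype ι] (r : ℝ) :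
    {z | ‖latticeEmbedding ι z‖ ≤ r}.Finite := by
  classical
  refine (Set.finite_Icc ((-⌈r⌉, fun _ => -⌈r⌉) : ℤ × (ι → ℤ)) (⌈r⌉, fun _ => ⌈r⌉)).subset ?_
  intro z hz
  have hcast : ∀ m : ℤ, ‖(m : ℝ)‖ ≤ r → -⌈r⌉ ≤ m ∧ m ≤ ⌈r⌉ := fun m hm => by
    rw [Real.norm_eq_abs] at hm
    have h := hm.trans (Int.le_ceil r)
    rw [← abs_le]
    exact_mod_cast h
  have h1 := hcast z.1 ((norm_fst_le (latticeEmbedding ι z)).trans hz)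
  have h2 := fun i => hcast (z.2 i)
    ((norm_le_pi_norm _ i).trans ((norm_snd_le (latticeEmbedding ι z)).trans hz))
  exact ⟨⟨h1.1, fun i => (h2 i).1⟩, ⟨h1.2, fun i => (h2 i).2⟩⟩

theorem span_range_latticeEmbedding (ι : Type*) [Fintype ι] :
    Submodule.span ℝ (Set.range (latticeEmbedding ι)) = ⊤ := by
  classical
  refine eq_top_iff.2 fun p _ => ?_
  have hp : p = p.1 • latticeEmbedding ι (1, 0) +
      ∑ i, p.2 i • latticeEmbedding ι (0, Pi.single i 1) := by
    ext j
    · simp [latticeEmbedding_apply, Prod.fst_sum]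
    · simp [latticeEmbedding_apply, Prod.snd_sum, Pi.single_apply]
  rw [hp]
  exact add_mem (Submodule.smul_mem _ _ (Submodule.subset_span ⟨_, rfl⟩))
    (sum_mem fun i _ => Submodule.smul_mem _ _ (Submodule.subset_span ⟨_, rfl⟩))

/-- The section at height one of a closed cone meeting height zero only at the origin is bounded. -/
theorem isBounded_section_of_cone {V : Type*} [NormedAddCommGroup V] [NormedSpace ℝ V]
    [FiniteDimensional ℝ V] {C : Set (ℝ × V)} (hC : IsClosed C)
    (hsmul : ∀ c : ℝ, 0 < c → ∀ p ∈ C, c • p ∈ C) (h0 : ∀ p ∈ C, p.1 = 0 → p = 0) :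
    Bornology.IsBounded {x : V | ((1 : ℝ), x) ∈ C} := by
  have hcomp : IsCompact (C ∩ Set.Icc (0 : ℝ) 1 ×ˢ Metric.sphere (0 : V) 1) :=
    (isCompact_Icc.prod (isCompact_sphere 0 1)).inter_left hC
  obtain ⟨m, hm, hmC⟩ : ∃ m : ℝ, 0 < m ∧
      ∀ p ∈ C ∩ Set.Icc (0 : ℝ) 1 ×ˢ Metric.sphere (0 : V) 1, m ≤ p.1 := by
    rcases (C ∩ Set.Icc (0 : ℝ) 1 ×ˢ Metric.sphere (0 : V) 1).eq_empty_or_nonempty with he | hne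
    · exact ⟨1, one_pos, by simp [he]⟩
    · obtain ⟨p, hp, hmin⟩ := hcomp.exists_isMinOn hne continuous_fst.continuousOn
      refine ⟨p.1, lt_of_le_of_ne hp.2.1.1 fun hp0 => ?_, fun q hq => hmin hq⟩
      have hp1 : ‖p.2‖ = 1 := by simpa using hp.2.2
      simp [h0 p hp.1 hp0.symm] at hp1
  refine isBounded_iff_forall_norm_le.2 ⟨max 1 m⁻¹, fun x hx => ?_⟩
  rcases le_total ‖x‖ 1 with h1 | h1
  · exact h1.trans (le_max_left _ _)
  · have hpos : 0 < ‖x‖ := one_pos.trans_le h1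
    have hmem := hmC (‖x‖⁻¹ • ((1 : ℝ), x)) ⟨hsmul _ (inv_pos.2 hpos) _ hx, by
      simpa using inv_le_one_of_one_le₀ h1, by simp [norm_smul, hpos.ne']⟩
    refine le_trans ?_ (le_max_right _ _)
    rw [le_inv_comm₀ hpos hm]
    simpa using hmem

/-- A point of the interior of the section at height one of a cone is interior to the cone. -/
theorem mk_one_mem_interior_of_cone {V : Type*} [NormedAddCommGroup V] [NormedSpace ℝ V]
    {C : Set (ℝ × V)} (hsmul : ∀ c : ℝ, 0 < c → ∀ p ∈ C, c • p ∈ C) {x : V}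
    (hx : x ∈ interior {x : V | ((1 : ℝ), x) ∈ C}) : ((1 : ℝ), x) ∈ interior C := by
  rw [mem_interior_iff_mem_nhds] at hx ⊢
  have hcont : ContinuousAt (fun p : ℝ × V => p.1⁻¹ • p.2) (1, x) :=
    (continuousAt_fst.inv₀ one_ne_zero).smul continuousAt_snd
  have hpre := hcont.preimage_mem_nhds (by simpa using hx)
  have hone : ((1 : ℝ), x) ∈ {p : ℝ × V | 0 < p.1} := by simp
  filter_upwards [hpre, (isOpen_lt continuous_const continuous_fst).mem_nhds hone] with p hp hp0
  convert hsmul p.1 hp0 _ hp using 1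
  ext <;> simp [smul_inv_smul₀ hp0.ne']

/-- The smallest closed convex cone containing a set is contained in the closure of its span over
the nonnegative reals. -/
theorem sInter_closed_convex_cone_subset {V : Type*} [NormedAddCommGroup V] [NormedSpace ℝ V]
    (X : Set V) :
    ⋂₀ {S : Set V | X ⊆ S ∧ IsClosed S ∧ Convex ℝ S ∧ ∀ c : ℝ, 0 < c → c • S ⊆ S} ⊆
      closure (Submodule.span ℝ≥0 X : Set V) := by
  refine Set.sInter_subset_of_mem ⟨Submodule.subset_span.trans subset_closure, isClosed_closure,
    (Submodule.convex_nnreal _).closure, fun c hc => ?_⟩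
  rw [← closure_smul₀]
  refine closure_mono ?_
  rintro _ ⟨x, hx, rfl⟩
  exact (Submodule.span ℝ≥0 X).smul_mem ⟨c, hc.le⟩ hx

theorem okounkov_body_integral_limit
    (d : ℕ) (hd : 1 ≤ d)
    (Γ : AddSubmonoid (ℤ × (Fin d → ℤ)))
    (hΓnat : ∀ γ ∈ Γ, 0 ≤ γ.1)
    -- the embedding of `ℤ × ℤ^d` into `ℝ × ℝ^d`
    (emb : ℤ × (Fin d → ℤ) → ℝ × (Fin d → ℝ))
    (hemb : ∀ γ, emb γ = ((γ.1 : ℝ), fun i => (γ.2 i : ℝ)))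
    -- `C(Γ)`, the smallest closed convex cone containing `Γ`
    (C : Set (ℝ × (Fin d → ℝ)))
    (hC : C = ⋂₀ {S : Set (ℝ × (Fin d → ℝ)) | emb '' (Γ : Set (ℤ × (Fin d → ℤ))) ⊆ S ∧
        IsClosed S ∧ Convex ℝ S ∧ ∀ c : ℝ, 0 < c → c • S ⊆ S})
    -- the Okounkov body `Δ(Γ)`
    (Δ : Set (Fin d → ℝ)) (hΔ : Δ = {x : Fin d → ℝ | ((1 : ℝ), x) ∈ C})
    -- (a) `Γ` generates `ℤ × ℤ^d` as a group
    (ha : AddSubgroup.closure (Γ : Set (ℤ × (Fin d → ℤ))) = ⊤)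
    -- (b) `C(Γ) ∩ ({0} × ℝ^d) = {0}`
    (hb : C ∩ {p : ℝ × (Fin d → ℝ) | p.1 = 0} = {(0 : ℝ × (Fin d → ℝ))})
    -- a polynomial function of degree `n` and its top homogeneous component `f`
    (F : MvPolynomial (Fin d) ℝ) (n : ℕ) (hn : F.totalDegree = n)
    (f : MvPolynomial (Fin d) ℝ) (hf : f = MvPolynomial.homogeneousComponent n F) :
    Tendsto
      (fun K : ℕ =>
        (∑ᶠ x ∈ {x : Fin d → ℤ | ((K : ℤ), x) ∈ Γ},
            MvPolynomial.eval (fun i => (x i : ℝ)) F) / (K : ℝ) ^ (n + d))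
      atTop
      (nhds (∫ x in Δ, MvPolynomial.eval x f ∂volume)) := by
  obtain rfl : emb = latticeEmbedding (Fin d) := funext fun z => (hemb z).trans rfl
  subst hn hf
  have hCclosed : IsClosed C := hC ▸ isClosed_sInter fun S hS => hS.2.1
  have hCconvex : Convex ℝ C := hC ▸ convex_sInter fun S hS => hS.2.2.1
  have hCsmul : ∀ c : ℝ, 0 < c → ∀ p ∈ C, c • p ∈ C := by
    intro c hc p hp
    rw [hC] at hp ⊢
    exact fun S hS => hS.2.2.2 c hc (Set.smul_mem_smul_set (hp S hS))
  have hΓC : ∀ z ∈ Γ, latticeEmbedding (Fin d) z ∈ C := by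
    intro z hz
    rw [hC]
    exact fun S hS => hS.1 (Set.mem_image_of_mem _ hz)
  have hslice : Continuous fun x : Fin d → ℝ => ((1 : ℝ), x) := by fun_prop
  have hΔclosed : IsClosed Δ := hΔ ▸ hCclosed.preimage hslice
  have hΔbdd : Bornology.IsBounded Δ := hΔ ▸ isBounded_section_of_cone hCclosed hCsmul
    fun p hp hp0 => by simpa using hb.subset ⟨hp, hp0⟩
  have hΔcomp : IsCompact Δ := Metric.isCompact_of_isClosed_isBounded hΔclosed hΔbdd
  have hΔconvex : Convex ℝ Δ := by
    rw [hΔ]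
    intro x hx y hy a b ha' hb' hab
    simpa [hab] using hCconvex hx hy ha' hb' hab
  have hscale : ∀ K : ℕ, K ≠ 0 → ∀ x : Fin d → ℤ,
      (K : ℝ)⁻¹ • latticeEmbedding (Fin d) ((K : ℤ), x) = (1, rescaledPoint K x) := by
    intro K hK x
    have hK' : (K : ℝ) ≠ 0 := Nat.cast_ne_zero.2 hK
    ext <;> simp [latticeEmbedding_apply, rescaledPoint, hK']
  have hΛ : ∀ K : ℕ, K ≠ 0 → {x : Fin d → ℤ | ((K : ℤ), x) ∈ Γ} ⊆ rescaledPoint K ⁻¹' Δ := by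
    intro K hK x hx
    rw [Set.mem_preimage, hΔ, Set.mem_ofPred_eq, ← hscale K hK]
    exact hCsmul _ (by positivity) _ (hΓC _ hx)
  have hintC : interior C ⊆
      interior (Submodule.span ℝ≥0 (latticeEmbedding (Fin d) '' Γ) : Set (ℝ × (Fin d → ℝ))) := by
    rw [← (Submodule.convex_nnreal _).interior_closure_eq_interior_of_nonempty_interior
      (Γ.interior_span_nnreal_nonempty ha _ (span_range_latticeEmbedding _)), hC]
    exact interior_mono (sInter_closed_convex_cone_subset _)
  have hexhaust : ∀ L ⊆ interior Δ, IsCompact L → Convex ℝ L →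
      ∀ᶠ K : ℕ in atTop, rescaledPoint K ⁻¹' L ⊆ {x : Fin d → ℤ | ((K : ℤ), x) ∈ Γ} := by
    intro L hLΔ hL hLc
    have hL' := Γ.eventually_mem_of_inv_smul_mem ha _ finite_norm_latticeEmbedding_le
      (isCompact_singleton (x := (1 : ℝ)).prod hL) ((convex_singleton (1 : ℝ)).prod hLc) <| by
        rintro ⟨t, x⟩ ⟨rfl, hx⟩
        exact hintC (mk_one_mem_interior_of_cone hCsmul (hΔ ▸ hLΔ hx))
    filter_upwards [hL', eventually_ne_atTop 0] with K hK hK0 x hx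
    exact hK _ (by rw [hscale K hK0]; exact ⟨rfl, hx⟩)
  have hfin : ∀ K : ℕ, K ≠ 0 → {x : Fin d → ℤ | ((K : ℤ), x) ∈ Γ}.Finite := fun K hK =>
    (finite_preimage_rescaledPoint hK hΔbdd).subset (hΛ K hK)
  simpa only [Fintype.card_fin] using tendsto_finsum_eval_div_pow hfin
    (fun G hG => tendsto_finsum_rescaledPoint_of_exhausts hΔcomp hΔconvex hΛ hexhaust hG) F
end
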